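/- For all integers k ≥ 1, t ≥ 2 with k + t ≥ 4 and c ∈ {0,1}, the set 𝓩 = {1, (αβγ)^i + (βγα)^i + (γαβ)^i (1 ≤ i ≤ k−1), (βγα)^{k−1}βγ, (αβγ)^k, η^j (2 ≤ j ≤ t), η + (αβγ)^{k−1}α} is an F-basis of the center Z(B^{k,t}_c); in particular dim_F Z(B^{k,t}_c) = k + t + 2. -/

import Mathlib

/- Common setup: the algebras B^{k,t}_c = SD(2B)₂^{k,t}(c) of semidihedral type,
   over a field F, presented as a quotient of the free algebra on the paths-generators
   e₁, e₂ (trivial paths), α (loop at vertex 1), β (arrow 1 → 2),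
   γ (arrow 2 → 1), η (loop at vertex 2), by the path-algebra relations
   together with Erdmann's relations  βη = (αβγ)^{k-1}αβ, γβ = η^{t-1},
   ηγ = (γαβ)^{k-1}γα, βη² = 0, η²γ = 0, α² = c(αβγ)^k. -/

noncomputable section

namespace SD2Paper

inductive Gen : Type
  | e1 | e2 | a | b | g | h

variable (F : Type) [Field F]

/-- The generators inside the free algebra. -/
def gen (t : Gen) : FreeAlgebra F Gen := FreeAlgebra.ι F t

/-- The defining relations of `D(2B)^{k,s}(c)` (paths written from left to right). -/
inductive Rel (k t : ℕ) (c : F) : FreeAlgebra F Gen → FreeAlgebra F Gen → Prop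
  | unit : Rel k t c (gen F .e1 + gen F .e2) 1
  | idem1 : Rel k t c (gen F .e1 * gen F .e1) (gen F .e1)
  | idem2 : Rel k t c (gen F .e2 * gen F .e2) (gen F .e2)
  | orth12 : Rel k t c (gen F .e1 * gen F .e2) 0
  | orth21 : Rel k t c (gen F .e2 * gen F .e1) 0
  | aL : Rel k t c (gen F .e1 * gen F .a) (gen F .a)
  | aR : Rel k t c (gen F .a * gen F .e1) (gen F .a)
  | bL : Rel k t c (gen F .e1 * gen F .b) (gen F .b)
  | bR : Rel k t c (gen F .b * gen F .e2) (gen F .b)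
  | gL : Rel k t c (gen F .e2 * gen F .g) (gen F .g)
  | gR : Rel k t c (gen F .g * gen F .e1) (gen F .g)
  | hL : Rel k t c (gen F .e2 * gen F .h) (gen F .h)
  | hR : Rel k t c (gen F .h * gen F .e2) (gen F .h)
  | bh : Rel k t c (gen F .b * gen F .h)
      ((gen F .a * gen F .b * gen F .g) ^ (k - 1) * (gen F .a * gen F .b))
  | gb : Rel k t c (gen F .g * gen F .b) ((gen F .h) ^ (t - 1))
  | hg : Rel k t c (gen F .h * gen F .g)
      ((gen F .g * gen F .a * gen F .b) ^ (k - 1) * (gen F .g * gen F .a))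
  | bh2 : Rel k t c (gen F .b * gen F .h * gen F .h) 0
  | h2g : Rel k t c (gen F .h * gen F .h * gen F .g) 0
  | asq : Rel k t c (gen F .a * gen F .a) (c • (gen F .a * gen F .b * gen F .g) ^ k)

/-- The algebra `B^{k,t}_c = SD(2B)₂^{k,t}(c)`. -/
def BA (k t : ℕ) (c : F) : Type := RingQuot (Rel F k t c)

instance (k t : ℕ) (c : F) : Ring (BA F k t c) :=
  inferInstanceAs (Ring (RingQuot (Rel F k t c)))

instance (k t : ℕ) (c : F) : Algebra F (BA F k t c) :=
  inferInstanceAs (Algebra F (RingQuot (Rel F k t c)))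

variable (k t : ℕ) (c : F)

/-- The canonical projection. -/
def mk : FreeAlgebra F Gen →ₐ[F] BA F k t c := RingQuot.mkAlgHom F (Rel F k t c)

def E1 : BA F k t c := mk F k t c (gen F .e1)
def E2 : BA F k t c := mk F k t c (gen F .e2)
/-- The image of the loop α at vertex 1. -/
def Al : BA F k t c := mk F k t c (gen F .a)
/-- The image of the arrow β : 1 → 2. -/
def Be : BA F k t c := mk F k t c (gen F .b)
/-- The image of the arrow γ : 2 → 1. -/
def Ga : BA F k t c := mk F k t c (gen F .g)
/-- The image of the loop η at vertex 2. -/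
def Et : BA F k t c := mk F k t c (gen F .h)

/-- The path αβγ. -/
def ABG : BA F k t c := Al F k t c * Be F k t c * Ga F k t c
/-- The path βγα. -/
def BGA : BA F k t c := Be F k t c * Ga F k t c * Al F k t c
/-- The path γαβ. -/
def GAB : BA F k t c := Ga F k t c * Al F k t c * Be F k t c

/-- The standard basis paths 𝓑₁₁ of e₁Ae₁. -/
def B11 : Set (BA F k t c) :=
  {E1 F k t c, Al F k t c, Be F k t c * Ga F k t c, (ABG F k t c) ^ k}
    ∪ (fun i => (ABG F k t c) ^ i) '' Set.Icc 1 (k - 1)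
    ∪ (fun i => (ABG F k t c) ^ i * Al F k t c) '' Set.Icc 1 (k - 1)
    ∪ (fun i => (BGA F k t c) ^ i) '' Set.Icc 1 (k - 1)
    ∪ (fun i => (BGA F k t c) ^ i * (Be F k t c * Ga F k t c)) '' Set.Icc 1 (k - 1)

/-- The standard basis paths 𝓑₁₂ of e₁Ae₂. -/
def B12 : Set (BA F k t c) :=
  {Be F k t c, Al F k t c * Be F k t c}
    ∪ (fun i => (BGA F k t c) ^ i * Be F k t c) '' Set.Icc 1 (k - 1)
    ∪ (fun i => (ABG F k t c) ^ i * (Al F k t c * Be F k t c)) '' Set.Icc 1 (k - 1)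

/-- The standard basis paths 𝓑₂₁ of e₂Ae₁. -/
def B21 : Set (BA F k t c) :=
  {Ga F k t c, Ga F k t c * Al F k t c}
    ∪ (fun i => (GAB F k t c) ^ i * Ga F k t c) '' Set.Icc 1 (k - 1)
    ∪ (fun i => (GAB F k t c) ^ i * (Ga F k t c * Al F k t c)) '' Set.Icc 1 (k - 1)

/-- The standard basis paths 𝓑₂₂ of e₂Ae₂. -/
def B22 : Set (BA F k t c) :=
  {E2 F k t c}
    ∪ (fun i => (GAB F k t c) ^ i) '' Set.Icc 1 (k - 1)
    ∪ (fun j => (Et F k t c) ^ j) '' Set.Icc 1 t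

/-- The standard path basis 𝓑 of `A^{k,s}_c`. -/
def BB : Set (BA F k t c) :=
  B11 F k t c ∪ B12 F k t c ∪ B21 F k t c ∪ B22 F k t c

/-- The commutator subspace K(A): the F-linear span of all commutators. -/
def Kspan (A : Type) [Ring A] [Algebra F A] : Submodule F A :=
  Submodule.span F {z : A | ∃ u v : A, z = u * v - v * u}

/-- The (left) socle of a ring: the sum of all simple (left) submodules. -/
def socle (A : Type) [Ring A] : Submodule A A := sSup {S : Submodule A A | IsAtom S}

/-- `ψ` is the linear form sending each standard basis path lying in the socle to 1
    and every other standard basis path to 0. -/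
def SoclePsi (ψ : BA F k t c →ₗ[F] F) : Prop :=
  ∀ p ∈ BB F k t c,
    (p ∈ socle (BA F k t c) → ψ p = 1) ∧ (p ∉ socle (BA F k t c) → ψ p = 0)

/-- `T₁(A) = {x : x² ∈ K(A)}`. -/
def T1set : Set (BA F k t c) := {z | z ^ 2 ∈ Kspan F (BA F k t c)}

/-- The orthogonal space `T₁(A)^⊥` with respect to the form `⟨x, y⟩ = ψ(xy)`. -/
def T1perp (ψ : BA F k t c →ₗ[F] F) : Set (BA F k t c) :=
  {y | ∀ x ∈ T1set F k t c, ψ (y * x) = 0}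

/-- The first generalized Reynolds ideal, as an ideal of the center `Z(A)`. -/
def ReynoldsIdeal (ψ : BA F k t c →ₗ[F] F) :
    Ideal (Subalgebra.center F (BA F k t c)) :=
  Ideal.span {z : Subalgebra.center F (BA F k t c) | (z : BA F k t c) ∈ T1perp F k t c ψ}


/-- The set 𝓩, a basis of the center of `B^{k,t}_c`. -/
def ZZ : Set (BA F k t c) :=
  {1, (BGA F k t c) ^ (k - 1) * (Be F k t c * Ga F k t c), (ABG F k t c) ^ k,
     Et F k t c + (ABG F k t c) ^ (k - 1) * Al F k t c}
    ∪ (fun i => (ABG F k t c) ^ i + (BGA F k t c) ^ i + (GAB F k t c) ^ i) ''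
        Set.Icc 1 (k - 1)
    ∪ (fun j => (Et F k t c) ^ j) '' Set.Icc 2 t

/-- Labels for the standard paths: the label `w i` stands for the path
ending in `w` that is preceded by `i` full turns around the cycle `αβγ`
(so `Word.abg i` is `(αβγ)^(i+1)`), and `h j` stands for `η^(j+1)`. -/
inductive Word : Type
  | e1 | e2
  | a (i : ℕ) | ga (i : ℕ) | bga (i : ℕ)
  | g (i : ℕ) | bg (i : ℕ) | abg (i : ℕ)
  | b (i : ℕ) | ab (i : ℕ) | gab (i : ℕ)
  | h (j : ℕ)
  deriving DecidableEq

/-- Whether the path with the given label starts at vertex `1`. -/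
def Word.startsAtOne : Word → Bool
  | .e1 | .a _ | .bga _ | .bg _ | .abg _ | .b _ | .ab _ => true
  | _ => false

/-- The labels of the standard basis of the algebra with `k = n + 1` and `t = m + 2`. -/
def Word.Reduced (n m : ℕ) : Word → Prop
  | .e1 | .e2 => True
  | .a i | .ga i | .bga i | .g i | .bg i | .b i | .ab i | .gab i => i ≤ n
  | .abg i => i < n
  | .h j => j ≤ m

/-- The defining relations of the algebra with `k = n + 1` and `t = m + 2`, for elements of an
arbitrary algebra. -/
structure Relations {R : Type*} [Ring R] [Algebra F R] (n m : ℕ) (c : F)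
    (e₁ e₂ a b g h : R) : Prop where
  unit : e₁ + e₂ = 1
  idem1 : e₁ * e₁ = e₁
  idem2 : e₂ * e₂ = e₂
  orth12 : e₁ * e₂ = 0
  orth21 : e₂ * e₁ = 0
  aL : e₁ * a = a
  aR : a * e₁ = a
  bL : e₁ * b = b
  bR : b * e₂ = b
  gL : e₂ * g = g
  gR : g * e₁ = g
  hL : e₂ * h = h
  hR : h * e₂ = h
  bh : b * h = (a * b * g) ^ n * (a * b)
  gb : g * b = h ^ (m + 1)
  hg : h * g = (g * a * b) ^ n * (g * a)
  bh2 : b * h * h = 0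
  h2g : h * h * g = 0
  asq : a * a = c • (a * b * g) ^ (n + 1)

/-- The path with the given label, evaluated at elements of an arbitrary algebra. -/
def Word.eval {R : Type*} [Ring R] (e₁ e₂ a b g h : R) : Word → R
  | .e1 => e₁
  | .e2 => e₂
  | .a i => (a * b * g) ^ i * a
  | .ga i => (g * a * b) ^ i * (g * a)
  | .bga i => (b * g * a) ^ (i + 1)
  | .g i => (g * a * b) ^ i * g
  | .bg i => (b * g * a) ^ i * (b * g)
  | .abg i => (a * b * g) ^ (i + 1)
  | .b i => (b * g * a) ^ i * b
  | .ab i => (a * b * g) ^ i * (a * b)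
  | .gab i => (g * a * b) ^ (i + 1)
  | .h j => h ^ (j + 1)

lemma mul_cycle_pow {R : Type*} [Ring R] (x y z : R) (i : ℕ) :
    x * (y * z * x) ^ i = (x * y * z) ^ i * x := by
  induction i with
  | zero => simp
  | succ i ih => rw [pow_succ, ← mul_assoc, ih, pow_succ]; simp only [mul_assoc]

namespace Relations

variable {F} {R : Type*} [Ring R] [Algebra F R] {n m : ℕ} {c : F} {e₁ e₂ a b g h : R}
  (H : Relations F n m c e₁ e₂ a b g h)
include H

lemma e1_mul_eval (w : Word) : e₁ * w.eval e₁ e₂ a b g h =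
    if w.startsAtOne then w.eval e₁ e₂ a b g h else 0 := by
  have ha (x : R) : e₁ * (a * x) = a * x := by rw [← mul_assoc, H.aL]
  have hb (x : R) : e₁ * (b * x) = b * x := by rw [← mul_assoc, H.bL]
  have hg : e₁ * g = 0 := by rw [← H.gL, ← mul_assoc, H.orth12, zero_mul]
  have hh : e₁ * h = 0 := by rw [← H.hL, ← mul_assoc, H.orth12, zero_mul]
  have hg' (x : R) : e₁ * (g * x) = 0 := by rw [← mul_assoc, hg, zero_mul]
  have hh' (x : R) : e₁ * (h * x) = 0 := by rw [← mul_assoc, hh, zero_mul]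
  rcases w with _ | _ | (_ | i) | (_ | i) | (_ | i) | (_ | i) | (_ | i) | (_ | i) | (_ | i) |
      (_ | i) | (_ | i) | (_ | i) <;>
    simp [Word.eval, Word.startsAtOne, pow_succ', mul_assoc, H.idem1, H.orth12, H.aL, H.bL,
      ha, hb, hg, hh, hg', hh']

lemma e2_mul_eval (w : Word) : e₂ * w.eval e₁ e₂ a b g h =
    if w.startsAtOne then 0 else w.eval e₁ e₂ a b g h := by
  have h1 := H.e1_mul_eval w
  have h2 : e₁ * w.eval e₁ e₂ a b g h + e₂ * w.eval e₁ e₂ a b g h = w.eval e₁ e₂ a b g h := by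
    rw [← add_mul, H.unit, one_mul]
  split_ifs at h1 ⊢ <;> simpa [h1] using h2

lemma mul_eval_eq_zero_of_mul_e1 {x : R} (hx : x * e₁ = x) {w : Word} (hw : ¬w.startsAtOne) :
    x * w.eval e₁ e₂ a b g h = 0 := by
  have := H.e1_mul_eval w
  rw [if_neg hw] at this
  rw [← hx, mul_assoc, this, mul_zero]

lemma mul_eval_eq_zero_of_mul_e2 {x : R} (hx : x * e₂ = x) {w : Word} (hw : w.startsAtOne) :
    x * w.eval e₁ e₂ a b g h = 0 := by
  have := H.e2_mul_eval w
  rw [if_pos hw] at this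
  rw [← hx, mul_assoc, this, mul_zero]

lemma abg_pow_mul_b : (a * b * g) ^ (n + 1) * b = 0 := by
  calc (a * b * g) ^ (n + 1) * b = b * h * (g * b) := by
        rw [H.bh, pow_succ]; simp only [mul_assoc]
    _ = b * h * h * h ^ m := by rw [H.gb, pow_succ', ← mul_assoc]
    _ = 0 := by rw [H.bh2, zero_mul]

lemma abg_pow_eq_bga_pow : (a * b * g) ^ (n + 1) = (b * g * a) ^ (n + 1) := by
  calc (a * b * g) ^ (n + 1) = b * h * g := by
        rw [H.bh, pow_succ]; simp only [mul_assoc]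
    _ = b * (g * a * b) ^ n * (g * a) := by rw [mul_assoc, H.hg, ← mul_assoc]
    _ = (b * g * a) ^ (n + 1) := by
        rw [mul_cycle_pow, pow_succ]; simp only [mul_assoc]

lemma aab : a * a * b = 0 := by rw [H.asq, smul_mul_assoc, H.abg_pow_mul_b, smul_zero]

lemma gaa : g * a * a = 0 := by
  calc g * a * a = c • (g * (b * h) * g) := by
        rw [mul_assoc, H.asq, mul_smul_comm, pow_succ, H.bh]; simp only [mul_assoc]
    _ = c • (h ^ m * (h * h * g)) := by rw [← mul_assoc, H.gb, pow_succ]; simp only [mul_assoc]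
    _ = 0 := by rw [H.h2g, mul_zero, smul_zero]

lemma hga : h * g * a = 0 := by
  rw [H.hg, mul_assoc, H.gaa, mul_zero]

lemma gbga : g * b * g * a = 0 := by
  rw [H.gb, pow_succ, mul_assoc, mul_assoc, ← mul_assoc h, H.hga, mul_zero]

lemma h_pow_eq : h ^ (m + 2) = (g * a * b) ^ (n + 1) := by
  rw [pow_succ, ← H.gb, mul_assoc, H.bh, ← mul_assoc, mul_cycle_pow, pow_succ]
  simp only [mul_assoc]

lemma h_pow_eq_zero : h ^ (m + 3) = 0 := by
  rw [pow_succ, pow_succ, ← H.gb, mul_assoc, mul_assoc, ← mul_assoc b, H.bh2, mul_zero]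

lemma abg_pow_mul_a : (a * b * g) ^ (n + 1) * a = 0 := by
  rw [← mul_cycle_pow, ← H.abg_pow_eq_bga_pow, pow_succ', ← mul_assoc, ← mul_assoc, ← mul_assoc,
    H.aab, zero_mul, zero_mul]

lemma gab_pow_mul_g : (g * a * b) ^ (n + 1) * g = 0 := by
  rw [← mul_cycle_pow, H.abg_pow_eq_bga_pow, pow_succ', ← mul_assoc, ← mul_assoc, ← mul_assoc,
    H.gbga, zero_mul]

lemma bga_pow_mul_b : (b * g * a) ^ (n + 1) * b = 0 := by
  rw [← H.abg_pow_eq_bga_pow, H.abg_pow_mul_b]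

omit H [Algebra F R] in
lemma pow_mul_eq_zero_of_le {x y : R} {i j : ℕ} (hxy : x ^ i * y = 0) (hij : i ≤ j) :
    x ^ j * y = 0 := by
  obtain ⟨d, rfl⟩ := Nat.exists_eq_add_of_le' hij
  rw [pow_add, mul_assoc, hxy, mul_zero]

lemma eval_mem_span (w : Word) : w.eval e₁ e₂ a b g h ∈
    Submodule.span F (Word.eval e₁ e₂ a b g h '' {w | w.Reduced n m}) := by
  by_cases hw : w.Reduced n m
  · exact Submodule.subset_span ⟨w, hw, rfl⟩
  cases w with
  | abg i =>
    rw [Word.Reduced, not_lt] at hw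
    rcases hw.eq_or_lt with rfl | hi
    · exact Submodule.subset_span ⟨.bga n, le_refl n, H.abg_pow_eq_bga_pow.symm⟩
    · rw [Word.eval, pow_succ, ← mul_assoc, ← mul_assoc,
        pow_mul_eq_zero_of_le H.abg_pow_mul_a hi, zero_mul, zero_mul]
      exact zero_mem _
  | h j =>
    rw [Word.Reduced, not_le] at hw
    rcases Nat.eq_or_lt_of_le hw with rfl | hj
    · exact Submodule.subset_span ⟨.gab n, le_refl n, H.h_pow_eq.symm⟩
    · rw [Word.eval, pow_eq_zero_of_le (show m + 3 ≤ j + 1 by lia) H.h_pow_eq_zero]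
      exact zero_mem _
  | e1 => exact absurd trivial hw
  | e2 => exact absurd trivial hw
  | _ i =>
    have hi : n + 1 ≤ i := by simpa [Word.Reduced] using hw
    simp only [Word.eval, pow_succ, ← mul_assoc, pow_mul_eq_zero_of_le H.abg_pow_mul_a hi,
      pow_mul_eq_zero_of_le H.bga_pow_mul_b hi, pow_mul_eq_zero_of_le H.gab_pow_mul_g hi,
      zero_mul, zero_mem]

lemma e1_mul_eval_mem_span (w : Word) : e₁ * w.eval e₁ e₂ a b g h ∈
    Submodule.span F (Word.eval e₁ e₂ a b g h '' {w | w.Reduced n m}) := by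
  rw [H.e1_mul_eval]
  split_ifs
  exacts [H.eval_mem_span w, zero_mem _]

lemma e2_mul_eval_mem_span (w : Word) : e₂ * w.eval e₁ e₂ a b g h ∈
    Submodule.span F (Word.eval e₁ e₂ a b g h '' {w | w.Reduced n m}) := by
  rw [H.e2_mul_eval]
  split_ifs
  exacts [zero_mem _, H.eval_mem_span w]

lemma a_mul_eval_mem_span (w : Word) : a * w.eval e₁ e₂ a b g h ∈
    Submodule.span F (Word.eval e₁ e₂ a b g h '' {w | w.Reduced n m}) := by
  have mem := H.eval_mem_span
  have cyc (i : ℕ) := mul_cycle_pow a b g i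
  by_cases hw : w.startsAtOne
  · cases w with
    | e1 => simpa [Word.eval, H.aR] using mem (.a 0)
    | a i =>
      rcases i with _ | i
      · simpa [Word.eval, H.asq] using Submodule.smul_mem _ c (mem (.abg n))
      · simp [Word.eval, pow_succ', ← mul_assoc, H.aab]
    | bga i => simpa [Word.eval, cyc] using mem (.a (i + 1))
    | bg i => simpa [Word.eval, ← mul_assoc, cyc, pow_succ] using mem (.abg i)
    | abg i => simp [Word.eval, pow_succ', ← mul_assoc, H.aab]
    | b i => simpa [Word.eval, ← mul_assoc, cyc] using mem (.ab i)
    | ab i => rcases i with _ | i <;> simp [Word.eval, pow_succ', ← mul_assoc, H.aab]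
    | _ => simp [Word.startsAtOne] at hw
  · rw [H.mul_eval_eq_zero_of_mul_e1 H.aR hw]
    exact zero_mem _

lemma b_mul_eval_mem_span (w : Word) : b * w.eval e₁ e₂ a b g h ∈
    Submodule.span F (Word.eval e₁ e₂ a b g h '' {w | w.Reduced n m}) := by
  have mem := H.eval_mem_span
  have cyc (i : ℕ) := mul_cycle_pow b g a i
  by_cases hw : w.startsAtOne
  · rw [H.mul_eval_eq_zero_of_mul_e2 H.bR hw]
    exact zero_mem _
  · cases w with
    | e2 => simpa [Word.eval, H.bR] using mem (.b 0)
    | ga i => simpa [Word.eval, ← mul_assoc, cyc, pow_succ] using mem (.bga i)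
    | g i => simpa [Word.eval, ← mul_assoc, cyc] using mem (.bg i)
    | gab i => simpa [Word.eval, cyc] using mem (.b (i + 1))
    | h j =>
      rcases j with _ | j
      · simpa [Word.eval, H.bh] using mem (.ab n)
      · simp [Word.eval, pow_succ', ← mul_assoc, H.bh2]
    | _ => simp [Word.startsAtOne] at hw

lemma g_mul_eval_mem_span (w : Word) : g * w.eval e₁ e₂ a b g h ∈
    Submodule.span F (Word.eval e₁ e₂ a b g h '' {w | w.Reduced n m}) := by
  have mem := H.eval_mem_span
  have cyc (i : ℕ) := mul_cycle_pow g a b i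
  by_cases hw : w.startsAtOne
  · cases w with
    | e1 => simpa [Word.eval, H.gR] using mem (.g 0)
    | a i => simpa [Word.eval, ← mul_assoc, cyc] using mem (.ga i)
    | bga i => simp [Word.eval, pow_succ', ← mul_assoc, H.gbga]
    | abg i => simpa [Word.eval, cyc] using mem (.g (i + 1))
    | ab i => simpa [Word.eval, ← mul_assoc, cyc, pow_succ] using mem (.gab i)
    | b i =>
      rcases i with _ | i
      · simpa [Word.eval, H.gb] using mem (.h m)
      · simp [Word.eval, pow_succ', ← mul_assoc, H.gbga]
    | bg i =>
      rcases i with _ | i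
      · rcases m with _ | m
        · simpa [Word.eval, ← mul_assoc, H.gb, H.hg] using mem (.ga n)
        · simp [Word.eval, ← mul_assoc, H.gb, pow_succ]
          simp [mul_assoc, (mul_assoc h h g).symm.trans H.h2g]
      · simp [Word.eval, pow_succ', ← mul_assoc, H.gbga]
    | _ => simp [Word.startsAtOne] at hw
  · rw [H.mul_eval_eq_zero_of_mul_e1 H.gR hw]
    exact zero_mem _

lemma h_mul_eval_mem_span (w : Word) : h * w.eval e₁ e₂ a b g h ∈
    Submodule.span F (Word.eval e₁ e₂ a b g h '' {w | w.Reduced n m}) := by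
  have mem := H.eval_mem_span
  by_cases hw : w.startsAtOne
  · rw [H.mul_eval_eq_zero_of_mul_e2 H.hR hw]
    exact zero_mem _
  · cases w with
    | e2 => simpa [Word.eval, H.hR] using mem (.h 0)
    | ga i => rcases i with _ | i <;> simp [Word.eval, pow_succ', ← mul_assoc, H.hga]
    | g i =>
      rcases i with _ | i
      · simpa [Word.eval, H.hg] using mem (.ga n)
      · simp [Word.eval, pow_succ', ← mul_assoc, H.hga]
    | gab i => simp [Word.eval, pow_succ', ← mul_assoc, H.hga]
    | h j => simpa [Word.eval, pow_succ'] using mem (.h (j + 1))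
    | _ => simp [Word.startsAtOne] at hw

end Relations

open Finsupp in
/-- The normal form of the path with the given label, for `k = n + 1` and `t = m + 2`. -/
def nf (n m : ℕ) : Word → (Word →₀ F)
  | .abg i => if i < n then single (.abg i) 1 else if i = n then single (.bga n) 1 else 0
  | .h j => if j ≤ m then single (.h j) 1 else if j = m + 1 then single (.gab n) 1 else 0
  | .e1 => single .e1 1
  | .e2 => single .e2 1
  | .a i => if i ≤ n then single (.a i) 1 else 0
  | .ga i => if i ≤ n then single (.ga i) 1 else 0
  | .bga i => if i ≤ n then single (.bga i) 1 else 0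
  | .g i => if i ≤ n then single (.g i) 1 else 0
  | .bg i => if i ≤ n then single (.bg i) 1 else 0
  | .b i => if i ≤ n then single (.b i) 1 else 0
  | .ab i => if i ≤ n then single (.ab i) 1 else 0
  | .gab i => if i ≤ n then single (.gab i) 1 else 0

/-- The product of a generator with a standard path, in normal form. -/
def act (n m : ℕ) (c : F) : Gen → Word → (Word →₀ F)
  | .e1, w => if w.startsAtOne then Finsupp.single w 1 else 0
  | .e2, w => if w.startsAtOne then 0 else Finsupp.single w 1
  | .a, .e1 => nf F n m (.a 0)
  | .a, .a i => if i = 0 then c • nf F n m (.bga n) else 0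
  | .a, .bga i => nf F n m (.a (i + 1))
  | .a, .bg i => nf F n m (.abg i)
  | .a, .b i => nf F n m (.ab i)
  | .b, .e2 => nf F n m (.b 0)
  | .b, .ga i => nf F n m (.bga i)
  | .b, .g i => nf F n m (.bg i)
  | .b, .gab i => nf F n m (.b (i + 1))
  | .b, .h j => if j = 0 then nf F n m (.ab n) else 0
  | .g, .e1 => nf F n m (.g 0)
  | .g, .a i => nf F n m (.ga i)
  | .g, .abg i => nf F n m (.g (i + 1))
  | .g, .ab i => nf F n m (.gab i)
  | .g, .b i => if i = 0 then nf F n m (.h m) else 0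
  | .g, .bg i => if i = 0 ∧ m = 0 then nf F n m (.ga n) else 0
  | .h, .e2 => nf F n m (.h 0)
  | .h, .g i => if i = 0 then nf F n m (.ga n) else 0
  | .h, .h j => nf F n m (.h (j + 1))
  | _, _ => 0

/-- The action of a generator on the left regular module. -/
def op (n m : ℕ) (c : F) (x : Gen) : Module.End F (Word →₀ F) :=
  Finsupp.linearCombination F (act F n m c x)

section Operators

variable {F}
variable {n m : ℕ} {c : F}

@[simp] lemma op_single (x : Gen) (w : Word) :
    op F n m c x (Finsupp.single w 1) = act F n m c x w := by
  simp [op]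

lemma op_e1_nf (w : Word) :
    op F n m c .e1 (nf F n m w) = if w.startsAtOne then nf F n m w else 0 := by
  cases w <;> simp only [nf] <;> split_ifs <;> simp_all [act, Word.startsAtOne]

lemma op_e2_nf (w : Word) :
    op F n m c .e2 (nf F n m w) = if w.startsAtOne then 0 else nf F n m w := by
  cases w <;> simp only [nf] <;> split_ifs <;> simp_all [act, Word.startsAtOne]

lemma op_a_nf (w : Word) : op F n m c .a (nf F n m w) = act F n m c .a w := by
  cases w <;> simp only [nf] <;> (try split_ifs) <;> simp [act, nf] <;> grind

lemma op_b_nf (w : Word) : op F n m c .b (nf F n m w) = act F n m c .b w := by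
  cases w <;> simp only [nf] <;> (try split_ifs) <;> simp [act, nf] <;> grind

lemma op_g_nf (w : Word) : op F n m c .g (nf F n m w) = act F n m c .g w := by
  cases w <;> simp only [nf] <;> (try split_ifs) <;> simp [act, nf] <;> grind

lemma op_h_nf (w : Word) : op F n m c .h (nf F n m w) = act F n m c .h w := by
  cases w <;> simp only [nf] <;> (try split_ifs) <;> simp [act, nf] <;> grind

lemma pow_apply_of_shift {M : Type*} [AddCommGroup M] [Module F M] {f : Module.End F M}
    {v : ℕ → M} (hf : ∀ i, f (v i) = v (i + 1)) (j i : ℕ) : (f ^ j) (v i) = v (i + j) := by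
  induction j generalizing i with
  | zero => simp
  | succ j ih => rw [pow_succ, Module.End.mul_apply, hf, ih]; congr 1; omega

lemma cycle_a_pow_nf (j i : ℕ) :
    ((op F n m c .a * op F n m c .b * op F n m c .g) ^ j) (nf F n m (.a i)) =
        nf F n m (.a (i + j)) ∧
      ((op F n m c .a * op F n m c .b * op F n m c .g) ^ j) (nf F n m (.abg i)) =
        nf F n m (.abg (i + j)) ∧
      ((op F n m c .a * op F n m c .b * op F n m c .g) ^ j) (nf F n m (.ab i)) =
        nf F n m (.ab (i + j)) := by
  refine ⟨pow_apply_of_shift (v := fun i => nf F n m (.a i)) (fun i => ?_) j i,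
    pow_apply_of_shift (v := fun i => nf F n m (.abg i)) (fun i => ?_) j i,
    pow_apply_of_shift (v := fun i => nf F n m (.ab i)) (fun i => ?_) j i⟩ <;>
  simp [op_a_nf, op_b_nf, op_g_nf, act]

lemma cycle_b_pow_nf (j i : ℕ) :
    ((op F n m c .b * op F n m c .g * op F n m c .a) ^ j) (nf F n m (.b i)) =
        nf F n m (.b (i + j)) ∧
      ((op F n m c .b * op F n m c .g * op F n m c .a) ^ j) (nf F n m (.bg i)) =
        nf F n m (.bg (i + j)) ∧
      ((op F n m c .b * op F n m c .g * op F n m c .a) ^ j) (nf F n m (.bga i)) =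
        nf F n m (.bga (i + j)) := by
  refine ⟨pow_apply_of_shift (v := fun i => nf F n m (.b i)) (fun i => ?_) j i,
    pow_apply_of_shift (v := fun i => nf F n m (.bg i)) (fun i => ?_) j i,
    pow_apply_of_shift (v := fun i => nf F n m (.bga i)) (fun i => ?_) j i⟩ <;>
  simp [op_a_nf, op_b_nf, op_g_nf, act]

lemma cycle_g_pow_nf (j i : ℕ) :
    ((op F n m c .g * op F n m c .a * op F n m c .b) ^ j) (nf F n m (.g i)) =
        nf F n m (.g (i + j)) ∧
      ((op F n m c .g * op F n m c .a * op F n m c .b) ^ j) (nf F n m (.ga i)) =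
        nf F n m (.ga (i + j)) ∧
      ((op F n m c .g * op F n m c .a * op F n m c .b) ^ j) (nf F n m (.gab i)) =
        nf F n m (.gab (i + j)) := by
  refine ⟨pow_apply_of_shift (v := fun i => nf F n m (.g i)) (fun i => ?_) j i,
    pow_apply_of_shift (v := fun i => nf F n m (.ga i)) (fun i => ?_) j i,
    pow_apply_of_shift (v := fun i => nf F n m (.gab i)) (fun i => ?_) j i⟩ <;>
  simp [op_a_nf, op_b_nf, op_g_nf, act]

lemma op_h_pow_nf (j i : ℕ) :
    (op F n m c .h ^ j) (nf F n m (.h i)) = nf F n m (.h (i + j)) :=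
  pow_apply_of_shift (v := fun i => nf F n m (.h i)) (fun i => by simp [op_h_nf, act]) j i

lemma op_ext {f f' : Module.End F (Word →₀ F)}
    (h : ∀ w, f (Finsupp.single w 1) = f' (Finsupp.single w 1)) : f = f' :=
  Finsupp.lhom_ext' fun w => LinearMap.ext_ring (h w)

variable (F n m c) in
/-- The left regular representation on the free algebra. -/
def freeRep : FreeAlgebra F Gen →ₐ[F] Module.End F (Word →₀ F) :=
  FreeAlgebra.lift F (op F n m c)

@[simp] lemma freeRep_gen (x : Gen) : freeRep F n m c (gen F x) = op F n m c x := by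
  simp [freeRep, gen]

lemma freeRep_rel {x y : FreeAlgebra F Gen} (r : Rel F (n + 1) (m + 2) c x y) :
    freeRep F n m c x = freeRep F n m c y := by
  cases r
  case bh =>
    simp only [map_mul, map_pow, freeRep_gen, Nat.add_sub_cancel]
    refine op_ext fun w => ?_
    rcases w with _ | _ | i | i | i | (_ | i) | i | i | i | i | i | (_ | i) <;>
      simp [act, op_a_nf, op_b_nf, cycle_a_pow_nf] <;> simp [nf]
  case gb =>
    simp only [map_mul, map_pow, freeRep_gen, show m + 2 - 1 = m + 1 from rfl]
    refine op_ext fun w => ?_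
    rcases w with _ | _ | i | i | i | (_ | i) | i | i | i | i | i | (_ | i) <;>
      rcases m with _ | m <;>
      simp [pow_succ, act, op_g_nf, op_h_nf, op_h_pow_nf] <;> simp [nf]
    all_goals grind
  case hg =>
    simp only [map_mul, map_pow, freeRep_gen, Nat.add_sub_cancel]
    refine op_ext fun w => ?_
    rcases w with _ | _ | (_ | i) | i | i | (_ | i) | (_ | i) | i | (_ | i) | i | i | (_ | i) <;>
      rcases m with _ | m <;>
      simp [act, op_g_nf, op_h_nf, cycle_g_pow_nf] <;> simp [nf]
  case asq =>
    simp only [map_mul, map_pow, map_smul, freeRep_gen]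
    refine op_ext fun w => ?_
    rcases w with _ | _ | (_ | i) | i | i | (_ | i) | (_ | i) | i | (_ | i) | i | i | (_ | i) <;>
      rcases m with _ | m <;>
      simp [pow_succ, act, op_a_nf, op_b_nf, cycle_a_pow_nf] <;> simp [nf]
  all_goals
    simp only [map_mul, map_add, map_one, map_zero, freeRep_gen]
    refine op_ext fun w => ?_
    rcases w with _ | _ | (_ | i) | i | i | (_ | i) | (_ | i) | i | (_ | i) | i | i | (_ | i) <;>
      rcases m with _ | m <;>
      simp [act, op_e1_nf, op_e2_nf, op_b_nf, op_h_nf, Word.startsAtOne]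
  all_goals simp [nf]

end Operators

section Coordinates

variable {F}
variable {n m : ℕ} {c : F}

lemma relations_BA : Relations F n m c (E1 F (n + 1) (m + 2) c) (E2 F (n + 1) (m + 2) c)
    (Al F (n + 1) (m + 2) c) (Be F (n + 1) (m + 2) c) (Ga F (n + 1) (m + 2) c)
    (Et F (n + 1) (m + 2) c) := by
  have key {x y : FreeAlgebra F Gen} (r : Rel F (n + 1) (m + 2) c x y) :
      mk F (n + 1) (m + 2) c x = mk F (n + 1) (m + 2) c y := RingQuot.mkAlgHom_rel F r
  constructor <;> simp only [E1, E2, Al, Be, Ga, Et]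
  · simpa only [map_add, map_one] using key .unit
  · simpa only [map_mul] using key .idem1
  · simpa only [map_mul] using key .idem2
  · simpa only [map_mul, map_zero] using key .orth12
  · simpa only [map_mul, map_zero] using key .orth21
  · simpa only [map_mul] using key .aL
  · simpa only [map_mul] using key .aR
  · simpa only [map_mul] using key .bL
  · simpa only [map_mul] using key .bR
  · simpa only [map_mul] using key .gL
  · simpa only [map_mul] using key .gR
  · simpa only [map_mul] using key .hL
  · simpa only [map_mul] using key .hR
  · simpa only [map_mul, map_pow, Nat.add_sub_cancel] using key .bh
  · simpa only [map_mul, map_pow, show m + 2 - 1 = m + 1 from rfl] using key .gb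
  · simpa only [map_mul, map_pow, Nat.add_sub_cancel] using key .hg
  · simpa only [map_mul, map_zero] using key .bh2
  · simpa only [map_mul, map_zero] using key .h2g
  · simpa only [map_mul, map_pow, map_smul] using key .asq

variable (F n m c) in
/-- The left regular representation, in coordinates. -/
def rep : BA F (n + 1) (m + 2) c →ₐ[F] Module.End F (Word →₀ F) :=
  RingQuot.liftAlgHom F ⟨freeRep F n m c, fun _ _ r => freeRep_rel r⟩

lemma rep_mk (x : FreeAlgebra F Gen) :
    rep F n m c (mk F (n + 1) (m + 2) c x) = freeRep F n m c x :=
  RingQuot.liftAlgHom_mkAlgHom_apply ..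

@[simp] lemma rep_E1 : rep F n m c (E1 F (n + 1) (m + 2) c) = op F n m c .e1 := by
  rw [E1, rep_mk, freeRep_gen]

@[simp] lemma rep_E2 : rep F n m c (E2 F (n + 1) (m + 2) c) = op F n m c .e2 := by
  rw [E2, rep_mk, freeRep_gen]

@[simp] lemma rep_Al : rep F n m c (Al F (n + 1) (m + 2) c) = op F n m c .a := by
  rw [Al, rep_mk, freeRep_gen]

@[simp] lemma rep_Be : rep F n m c (Be F (n + 1) (m + 2) c) = op F n m c .b := by
  rw [Be, rep_mk, freeRep_gen]

@[simp] lemma rep_Ga : rep F n m c (Ga F (n + 1) (m + 2) c) = op F n m c .g := by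
  rw [Ga, rep_mk, freeRep_gen]

@[simp] lemma rep_Et : rep F n m c (Et F (n + 1) (m + 2) c) = op F n m c .h := by
  rw [Et, rep_mk, freeRep_gen]

variable (F n m c) in
/-- The path with the given label, as an element of the algebra. -/
def path : Word → BA F (n + 1) (m + 2) c :=
  Word.eval (E1 F (n + 1) (m + 2) c) (E2 F (n + 1) (m + 2) c) (Al F (n + 1) (m + 2) c)
    (Be F (n + 1) (m + 2) c) (Ga F (n + 1) (m + 2) c) (Et F (n + 1) (m + 2) c)

variable (F n m c) in
/-- The coordinates of an element of the algebra with respect to the standard paths. -/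
def coords : BA F (n + 1) (m + 2) c →ₗ[F] (Word →₀ F) :=
  LinearMap.applyₗ (nf F n m .e1 + nf F n m .e2) ∘ₗ (rep F n m c).toLinearMap

lemma coords_apply (x : BA F (n + 1) (m + 2) c) :
    coords F n m c x = rep F n m c x (nf F n m .e1) + rep F n m c x (nf F n m .e2) := by
  simp [coords]

lemma coords_mul (x y : BA F (n + 1) (m + 2) c) :
    coords F n m c (x * y) = rep F n m c x (coords F n m c y) := by
  simp [coords_apply]

lemma coords_path (w : Word) : coords F n m c (path F n m c w) = nf F n m w := by
  cases w <;>
    simp [coords_apply, path, Word.eval, pow_succ, op_e1_nf, op_e2_nf, op_a_nf, op_b_nf, op_g_nf,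
      op_h_nf, act, Word.startsAtOne, cycle_a_pow_nf, cycle_b_pow_nf, cycle_g_pow_nf, op_h_pow_nf]

lemma nf_of_reduced {w : Word} (hw : w.Reduced n m) : nf F n m w = Finsupp.single w 1 := by
  cases w <;> simp_all [nf, Word.Reduced]

lemma eq_top_of_gen_mem (S : Subalgebra F (BA F (n + 1) (m + 2) c))
    (h : ∀ x : Gen, mk F (n + 1) (m + 2) c (gen F x) ∈ S) : S = ⊤ := by
  rw [eq_top_iff]
  rintro y -
  obtain ⟨y, rfl⟩ := RingQuot.mkAlgHom_surjective F (Rel F (n + 1) (m + 2) c) y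
  have : Algebra.adjoin F (Set.range (FreeAlgebra.ι F)) ≤ S.comap (mk F (n + 1) (m + 2) c) :=
    Algebra.adjoin_le (by rintro _ ⟨x, rfl⟩; exact h x)
  exact this (FreeAlgebra.adjoin_range_ι F Gen ▸ Algebra.mem_top)

lemma span_path : Submodule.span F (path F n m c '' {w | w.Reduced n m}) = ⊤ := by
  have H := relations_BA (n := n) (m := m) (c := c)
  set S := Submodule.span F (path F n m c '' {w | w.Reduced n m}) with hS
  let T : Subalgebra F (BA F (n + 1) (m + 2) c) :=
    { carrier := {x | ∀ y ∈ S, x * y ∈ S}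
      mul_mem' := fun hx hy z hz => by rw [mul_assoc]; exact hx _ (hy _ hz)
      add_mem' := fun hx hy z hz => by rw [add_mul]; exact add_mem (hx _ hz) (hy _ hz)
      algebraMap_mem' := fun r z hz => by rw [← Algebra.smul_def]; exact S.smul_mem r hz }
  have hT : T = ⊤ := by
    refine eq_top_of_gen_mem T fun x => ?_
    change S ≤ S.comap (LinearMap.mulLeft F _)
    refine Submodule.span_le.2 ?_
    rintro _ ⟨w, -, rfl⟩
    cases x
    · exact H.e1_mul_eval_mem_span w
    · exact H.e2_mul_eval_mem_span w
    · exact H.a_mul_eval_mem_span w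
    · exact H.b_mul_eval_mem_span w
    · exact H.g_mul_eval_mem_span w
    · exact H.h_mul_eval_mem_span w
  have h1 : (1 : BA F (n + 1) (m + 2) c) ∈ S := by
    rw [← H.unit]
    exact add_mem (H.eval_mem_span .e1) (H.eval_mem_span .e2)
  refine eq_top_iff.2 fun x _ => ?_
  have hx : x ∈ T := hT ▸ Algebra.mem_top
  simpa using hx 1 h1

lemma linearMap_ext_path {V : Type*} [AddCommGroup V] [Module F V]
    {f f' : BA F (n + 1) (m + 2) c →ₗ[F] V}
    (h : ∀ w : Word, w.Reduced n m → f (path F n m c w) = f' (path F n m c w)) : f = f' :=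
  LinearMap.ext_on span_path (by rintro _ ⟨w, hw, rfl⟩; exact h w hw)

lemma eq_zero_of_coords {x : BA F (n + 1) (m + 2) c}
    (hx : ∀ w : Word, w.Reduced n m → coords F n m c x w = 0) : x = 0 := by
  classical
  let f : (Word →₀ F) →ₗ[F] BA F (n + 1) (m + 2) c :=
    Finsupp.linearCombination F fun w => if w.Reduced n m then path F n m c w else 0
  have hf : f ∘ₗ coords F n m c = LinearMap.id := linearMap_ext_path fun w hw => by
    simp [f, coords_path, nf_of_reduced hw, hw]
  rw [← LinearMap.id_apply (R := F) x, ← hf, LinearMap.comp_apply]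
  refine (Finsupp.linearCombination_apply F _).trans (Finset.sum_eq_zero fun w _ => ?_)
  by_cases hw : w.Reduced n m
  · simp [hx w hw]
  · simp [hw]

lemma eq_of_coords_eq {x y : BA F (n + 1) (m + 2) c}
    (h : coords F n m c x = coords F n m c y) : x = y :=
  sub_eq_zero.1 (eq_zero_of_coords fun w _ => by rw [map_sub, h, sub_self, Finsupp.zero_apply])

lemma coords_E2 : coords F n m c (E2 F (n + 1) (m + 2) c) = nf F n m .e2 :=
  coords_path .e2

lemma coords_Al : coords F n m c (Al F (n + 1) (m + 2) c) = nf F n m (.a 0) := by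
  simp [← coords_path (c := c), path, Word.eval]

lemma coords_Be : coords F n m c (Be F (n + 1) (m + 2) c) = nf F n m (.b 0) := by
  simp [← coords_path (c := c), path, Word.eval]

lemma coords_Ga : coords F n m c (Ga F (n + 1) (m + 2) c) = nf F n m (.g 0) := by
  simp [← coords_path (c := c), path, Word.eval]

lemma coords_Et : coords F n m c (Et F (n + 1) (m + 2) c) = nf F n m (.h 0) := by
  simp [← coords_path (c := c), path, Word.eval]

/-- A coordinate of a commutator with `y` that is the linear form `φ` on the standard paths
gives a linear constraint on the coordinates of the elements commuting with `y`. -/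
lemma coords_of_commute {z y : BA F (n + 1) (m + 2) c} (hz : z * y = y * z) (r : Word)
    (φ : (Word →₀ F) →ₗ[F] F)
    (h : ∀ w : Word, w.Reduced n m → rep F n m c (path F n m c w) (coords F n m c y) r -
      rep F n m c y (nf F n m w) r = φ (nf F n m w)) : φ (coords F n m c z) = 0 := by
  have key : Finsupp.lapply r ∘ₗ coords F n m c ∘ₗ
      (LinearMap.mulRight F y - LinearMap.mulLeft F y) = φ ∘ₗ coords F n m c :=
    linearMap_ext_path fun w hw => by simpa [coords_mul, coords_path] using h w hw
  have := LinearMap.congr_fun key z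
  simpa [hz] using this.symm

section Commute

variable {z : BA F (n + 1) (m + 2) c}

section E2

variable (hz : z * E2 F (n + 1) (m + 2) c = E2 F (n + 1) (m + 2) c * z)
include hz

lemma coords_b_of_commute (i : ℕ) : coords F n m c z (.b i) = 0 := by
  suffices h : (Finsupp.lapply (.b i) : (Word →₀ F) →ₗ[F] F)
      (coords F n m c z) = 0 by
    simpa [sub_eq_zero] using h
  refine coords_of_commute hz (.b i) _ fun w hw => ?_
  rw [coords_E2, rep_E2]
  rcases w with _ | _ | (_ | i) | (_ | i) | (_ | i) | (_ | i) | (_ | i) |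
      (_ | i) | (_ | i) | (_ | i) | (_ | i) | (_ | i) <;>
    rcases m with _ | m <;>
    simp [path, Word.eval, pow_succ, op_e1_nf, op_e2_nf, op_a_nf, op_b_nf, op_g_nf, op_h_nf, act,
      Word.startsAtOne, cycle_a_pow_nf, cycle_b_pow_nf, cycle_g_pow_nf, op_h_pow_nf, add_comm 1] <;>
    simp [nf] <;> (try split_ifs) <;> simp_all [Word.Reduced]

lemma coords_ab_of_commute (i : ℕ) : coords F n m c z (.ab i) = 0 := by
  suffices h : (Finsupp.lapply (.ab i) : (Word →₀ F) →ₗ[F] F)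
      (coords F n m c z) = 0 by
    simpa [sub_eq_zero] using h
  refine coords_of_commute hz (.ab i) _ fun w hw => ?_
  rw [coords_E2, rep_E2]
  rcases w with _ | _ | (_ | i) | (_ | i) | (_ | i) | (_ | i) | (_ | i) |
      (_ | i) | (_ | i) | (_ | i) | (_ | i) | (_ | i) <;>
    rcases m with _ | m <;>
    simp [path, Word.eval, pow_succ, op_e1_nf, op_e2_nf, op_a_nf, op_b_nf, op_g_nf, op_h_nf, act,
      Word.startsAtOne, cycle_a_pow_nf, cycle_b_pow_nf, cycle_g_pow_nf, op_h_pow_nf, add_comm 1] <;>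
    simp [nf] <;> (try split_ifs) <;> simp_all [Word.Reduced]

lemma coords_g_of_commute (i : ℕ) : coords F n m c z (.g i) = 0 := by
  suffices h : (-Finsupp.lapply (.g i) : (Word →₀ F) →ₗ[F] F)
      (coords F n m c z) = 0 by
    simpa [sub_eq_zero] using h
  refine coords_of_commute hz (.g i) _ fun w hw => ?_
  rw [coords_E2, rep_E2]
  rcases w with _ | _ | (_ | i) | (_ | i) | (_ | i) | (_ | i) | (_ | i) |
      (_ | i) | (_ | i) | (_ | i) | (_ | i) | (_ | i) <;>
    rcases m with _ | m <;>
    simp [path, Word.eval, pow_succ, op_e1_nf, op_e2_nf, op_a_nf, op_b_nf, op_g_nf, op_h_nf, act,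
      Word.startsAtOne, cycle_a_pow_nf, cycle_b_pow_nf, cycle_g_pow_nf, op_h_pow_nf, add_comm 1] <;>
    simp [nf] <;> (try split_ifs) <;> simp_all [Word.Reduced]

lemma coords_ga_of_commute (i : ℕ) : coords F n m c z (.ga i) = 0 := by
  suffices h : (-Finsupp.lapply (.ga i) : (Word →₀ F) →ₗ[F] F)
      (coords F n m c z) = 0 by
    simpa [sub_eq_zero] using h
  refine coords_of_commute hz (.ga i) _ fun w hw => ?_
  rw [coords_E2, rep_E2]
  rcases w with _ | _ | (_ | i) | (_ | i) | (_ | i) | (_ | i) | (_ | i) |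
      (_ | i) | (_ | i) | (_ | i) | (_ | i) | (_ | i) <;>
    rcases m with _ | m <;>
    simp [path, Word.eval, pow_succ, op_e1_nf, op_e2_nf, op_a_nf, op_b_nf, op_g_nf, op_h_nf, act,
      Word.startsAtOne, cycle_a_pow_nf, cycle_b_pow_nf, cycle_g_pow_nf, op_h_pow_nf, add_comm 1] <;>
    simp [nf] <;> (try split_ifs) <;> simp_all [Word.Reduced]

end E2

section Al

variable (hz : z * Al F (n + 1) (m + 2) c = Al F (n + 1) (m + 2) c * z)
include hz

lemma coords_bg_of_commute {i : ℕ} (hi : i < n) : coords F n m c z (.bg i) = 0 := by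
  suffices h : (-Finsupp.lapply (.bg i) : (Word →₀ F) →ₗ[F] F)
      (coords F n m c z) = 0 by
    simpa [sub_eq_zero] using h
  refine coords_of_commute hz (.abg i) _ fun w hw => ?_
  rw [coords_Al, rep_Al]
  rcases w with _ | _ | (_ | i) | (_ | i) | (_ | i) | (_ | i) | (_ | i) |
      (_ | i) | (_ | i) | (_ | i) | (_ | i) | (_ | i) <;>
    rcases m with _ | m <;>
    simp [path, Word.eval, pow_succ, op_e1_nf, op_e2_nf, op_a_nf, op_b_nf, op_g_nf, op_h_nf, act,
      Word.startsAtOne, cycle_a_pow_nf, cycle_b_pow_nf, cycle_g_pow_nf, add_comm 1] <;>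
    simp [nf] <;> (try split_ifs) <;> simp_all [Finsupp.single_apply, Word.Reduced] <;> grind

lemma coords_abg_eq_bga_of_commute {i : ℕ} (hi : i < n) :
    coords F n m c z (.abg i) = coords F n m c z (.bga i) := by
  suffices h : (Finsupp.lapply (.abg i) - Finsupp.lapply (.bga i) : (Word →₀ F) →ₗ[F] F)
      (coords F n m c z) = 0 by
    simpa [sub_eq_zero] using h
  refine coords_of_commute hz (.a (i + 1)) _ fun w hw => ?_
  rw [coords_Al, rep_Al]
  rcases w with _ | _ | (_ | i) | (_ | i) | (_ | i) | (_ | i) | (_ | i) |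
      (_ | i) | (_ | i) | (_ | i) | (_ | i) | (_ | i) <;>
    rcases m with _ | m <;>
    simp [path, Word.eval, pow_succ, op_e1_nf, op_e2_nf, op_a_nf, op_b_nf, op_g_nf, op_h_nf, act,
      Word.startsAtOne, cycle_a_pow_nf, cycle_b_pow_nf, cycle_g_pow_nf, add_comm 1] <;>
    simp [nf] <;> (try split_ifs) <;> simp_all [Finsupp.single_apply, Word.Reduced] <;> grind

end Al

section Be

variable (hz : z * Be F (n + 1) (m + 2) c = Be F (n + 1) (m + 2) c * z)
include hz

lemma coords_e1_eq_e2_of_commute : coords F n m c z .e1 = coords F n m c z .e2 := by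
  suffices h : (Finsupp.lapply .e1 - Finsupp.lapply .e2 : (Word →₀ F) →ₗ[F] F)
      (coords F n m c z) = 0 by
    simpa [sub_eq_zero] using h
  refine coords_of_commute hz (.b 0) _ fun w hw => ?_
  rw [coords_Be, rep_Be]
  rcases w with _ | _ | (_ | i) | (_ | i) | (_ | i) | (_ | i) | (_ | i) |
      (_ | i) | (_ | i) | (_ | i) | (_ | i) | (_ | i) <;>
    rcases m with _ | m <;>
    simp [path, Word.eval, pow_succ, op_e1_nf, op_e2_nf, op_a_nf, op_b_nf, op_g_nf, op_h_nf, act,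
      Word.startsAtOne, cycle_a_pow_nf, cycle_b_pow_nf, cycle_g_pow_nf, add_comm 1] <;>
    simp [nf] <;> (try split_ifs) <;> simp_all [Word.Reduced]

lemma coords_bga_eq_gab_of_commute {i : ℕ} (hi : i < n) :
    coords F n m c z (.bga i) = coords F n m c z (.gab i) := by
  suffices h : (Finsupp.lapply (.bga i) - Finsupp.lapply (.gab i) : (Word →₀ F) →ₗ[F] F)
      (coords F n m c z) = 0 by
    simpa [sub_eq_zero] using h
  refine coords_of_commute hz (.b (i + 1)) _ fun w hw => ?_
  rw [coords_Be, rep_Be]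
  rcases w with _ | _ | (_ | i) | (_ | i) | (_ | i) | (_ | i) | (_ | i) |
      (_ | i) | (_ | i) | (_ | i) | (_ | i) | (_ | i) <;>
    rcases m with _ | m <;>
    simp [path, Word.eval, pow_succ, op_e1_nf, op_e2_nf, op_a_nf, op_b_nf, op_g_nf, op_h_nf, act,
      Word.startsAtOne, cycle_a_pow_nf, cycle_b_pow_nf, cycle_g_pow_nf, add_comm 1] <;>
    simp [nf] <;> (try split_ifs) <;> simp_all [Word.Reduced] <;> grind

lemma coords_a_of_commute {i : ℕ} (hi : i < n) : coords F n m c z (.a i) = 0 := by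
  suffices h : (Finsupp.lapply (.a i) : (Word →₀ F) →ₗ[F] F)
      (coords F n m c z) = 0 by
    simpa [sub_eq_zero] using h
  refine coords_of_commute hz (.ab i) _ fun w hw => ?_
  rw [coords_Be, rep_Be]
  rcases w with _ | _ | (_ | i) | (_ | i) | (_ | i) | (_ | i) | (_ | i) |
      (_ | i) | (_ | i) | (_ | i) | (_ | i) | (_ | i) <;>
    rcases m with _ | m <;>
    simp [path, Word.eval, pow_succ, op_e1_nf, op_e2_nf, op_a_nf, op_b_nf, op_g_nf, op_h_nf, act,
      Word.startsAtOne, cycle_a_pow_nf, cycle_b_pow_nf, cycle_g_pow_nf, add_comm 1] <;>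
    simp [nf] <;> (try split_ifs) <;> simp_all [Finsupp.single_apply, Word.Reduced] <;> grind

lemma coords_a_top_of_commute :
    coords F n m c z (.a n) + (if m = 0 then coords F n m c z (.bg 0) else 0) =
      coords F n m c z (.h 0) := by
  suffices h : (Finsupp.lapply (.a n) + (if m = 0 then Finsupp.lapply (.bg 0) else 0) -
      Finsupp.lapply (.h 0) : (Word →₀ F) →ₗ[F] F)
      (coords F n m c z) = 0 by
    split_ifs at h ⊢ <;> simpa [sub_eq_zero] using h
  refine coords_of_commute hz (.ab n) _ fun w hw => ?_
  rw [coords_Be, rep_Be]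
  rcases w with _ | _ | (_ | i) | (_ | i) | (_ | i) | (_ | i) | (_ | i) |
      (_ | i) | (_ | i) | (_ | i) | (_ | i) | (_ | i) <;>
    rcases m with _ | m <;>
    simp [path, Word.eval, pow_succ, op_e1_nf, op_e2_nf, op_a_nf, op_b_nf, op_g_nf, op_h_nf, act,
      Word.startsAtOne, cycle_a_pow_nf, cycle_b_pow_nf, cycle_g_pow_nf, add_comm 1] <;>
    simp [nf] <;> (try split_ifs) <;> simp_all [Finsupp.single_apply, Word.Reduced]

end Be

end Commute

variable (F n m c) in
/-- The members of the center basis, indexed so that `centerWord` labels a coordinate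
singling out each of them. -/
def centerElt : Fin 5 ⊕ Fin n ⊕ Fin m → BA F (n + 1) (m + 2) c
  | .inl 0 => path F n m c .e1 + path F n m c .e2
  | .inl 1 => path F n m c (.bg n)
  | .inl 2 => path F n m c (.bga n)
  | .inl 3 => path F n m c (.h 0) + path F n m c (.a n)
  | .inl 4 => path F n m c (.gab n)
  | .inr (.inl i) => path F n m c (.abg i) + path F n m c (.bga i) + path F n m c (.gab i)
  | .inr (.inr j) => path F n m c (.h (j + 1))

/-- The label of the coordinate dual to `centerElt`. -/
def centerWord (n m : ℕ) : Fin 5 ⊕ Fin n ⊕ Fin m → Word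
  | .inl 0 => .e1
  | .inl 1 => .bg n
  | .inl 2 => .bga n
  | .inl 3 => .h 0
  | .inl 4 => .gab n
  | .inr (.inl i) => .abg i
  | .inr (.inr j) => .h (j + 1)

lemma coords_centerElt (i j : Fin 5 ⊕ Fin n ⊕ Fin m) :
    coords F n m c (centerElt F n m c i) (centerWord n m j) = if i = j then 1 else 0 := by
  rcases i with i | i | i <;> rcases j with j | j | j <;> try fin_cases i <;> try fin_cases j
  all_goals simp [centerElt, centerWord, coords_path, nf, Finsupp.single_apply]
  all_goals grind

lemma linearIndependent_centerElt : LinearIndependent F (centerElt F n m c) := by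
  refine LinearIndependent.of_comp
    (LinearMap.pi fun j => Finsupp.lapply (centerWord n m j) ∘ₗ coords F n m c) ?_
  rw [show _ ∘ _ = fun i => Pi.single i (1 : F) from ?_]
  · exact Pi.linearIndependent_single_one (Fin 5 ⊕ Fin n ⊕ Fin m) F
  · ext i j
    simp [coords_centerElt, Pi.single_apply, eq_comm]

lemma eq_zero_of_mem_center {z : BA F (n + 1) (m + 2) c}
    (hz : z ∈ Subalgebra.center F (BA F (n + 1) (m + 2) c))
    (h : ∀ j, coords F n m c z (centerWord n m j) = 0) : z = 0 := by
  have hc (y : BA F (n + 1) (m + 2) c) : z * y = y * z := (Subalgebra.mem_center_iff.1 hz y).symm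
  have habg {i : ℕ} (hi : i < n) : coords F n m c z (.abg i) = 0 := h (.inr (.inl ⟨i, hi⟩))
  have hbg {i : ℕ} (hi : i ≤ n) : coords F n m c z (.bg i) = 0 :=
    hi.lt_or_eq.elim (coords_bg_of_commute (hc _)) fun hi => hi ▸ h (.inl 1)
  have hbga {i : ℕ} (hi : i < n) : coords F n m c z (.bga i) = 0 := by
    rw [← coords_abg_eq_bga_of_commute (hc _) hi, habg hi]
  refine eq_zero_of_coords fun w hw => ?_
  cases w with
  | e1 => exact h (.inl 0)
  | e2 => rw [← coords_e1_eq_e2_of_commute (hc _)]; exact h (.inl 0)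
  | a i =>
    rcases Nat.lt_or_eq_of_le hw with hi | rfl
    · exact coords_a_of_commute (hc _) hi
    · simpa [hbg, h (.inl 3), centerWord] using
        (coords_a_top_of_commute (hc _)).trans (h (.inl 3))
  | ga i => exact coords_ga_of_commute (hc _) i
  | bga i => exact (Nat.lt_or_eq_of_le hw).elim hbga fun hi => hi ▸ h (.inl 2)
  | g i => exact coords_g_of_commute (hc _) i
  | bg i => exact hbg hw
  | abg i => exact habg hw
  | b i => exact coords_b_of_commute (hc _) i
  | ab i => exact coords_ab_of_commute (hc _) i
  | gab i =>
    rcases Nat.lt_or_eq_of_le hw with hi | rfl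
    · rw [← coords_bga_eq_gab_of_commute (hc _) hi, hbga hi]
    · exact h (.inl 4)
  | h j =>
    rcases j with _ | j
    · exact h (.inl 3)
    · exact h (.inr (.inr ⟨j, hw⟩))

lemma mem_center_of_commute_gen {z : BA F (n + 1) (m + 2) c}
    (hE1 : E1 F (n + 1) (m + 2) c * z = z * E1 F (n + 1) (m + 2) c)
    (hE2 : E2 F (n + 1) (m + 2) c * z = z * E2 F (n + 1) (m + 2) c)
    (hAl : Al F (n + 1) (m + 2) c * z = z * Al F (n + 1) (m + 2) c)
    (hBe : Be F (n + 1) (m + 2) c * z = z * Be F (n + 1) (m + 2) c)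
    (hGa : Ga F (n + 1) (m + 2) c * z = z * Ga F (n + 1) (m + 2) c)
    (hEt : Et F (n + 1) (m + 2) c * z = z * Et F (n + 1) (m + 2) c) :
    z ∈ Subalgebra.center F (BA F (n + 1) (m + 2) c) := by
  have key : Subalgebra.centralizer F {z} = ⊤ := eq_top_of_gen_mem _ fun x => by
    rw [Subalgebra.mem_centralizer_iff]
    rintro _ rfl
    cases x
    exacts [hE1.symm, hE2.symm, hAl.symm, hBe.symm, hGa.symm, hEt.symm]
  refine Subalgebra.mem_center_iff.2 fun y => ?_
  have hy : y ∈ Subalgebra.centralizer F {z} := key ▸ Algebra.mem_top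
  exact (hy z rfl).symm

lemma coords_E1 : coords F n m c (E1 F (n + 1) (m + 2) c) = nf F n m .e1 :=
  coords_path .e1

set_option maxHeartbeats 4000000 in
lemma centerElt_mem_center (hnm : 1 ≤ n + m) (j : Fin 5 ⊕ Fin n ⊕ Fin m) :
    centerElt F n m c j ∈ Subalgebra.center F (BA F (n + 1) (m + 2) c) := by
  apply mem_center_of_commute_gen <;> refine eq_of_coords_eq ?_ <;>
    rcases j with j | j | j <;> (try fin_cases j) <;>
    rcases n with _ | n <;> rcases m with _ | m <;>
    simp [coords_mul, coords_E1, coords_E2, coords_Al, coords_Be, coords_Ga, coords_Et, centerElt,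
      path, Word.eval, pow_succ, op_e1_nf, op_e2_nf, op_a_nf, op_b_nf, op_g_nf, op_h_nf,
      act, Word.startsAtOne, cycle_a_pow_nf, cycle_b_pow_nf, cycle_g_pow_nf, op_h_pow_nf,
      add_comm 1]
  all_goals simp [nf, add_comm 2] at hnm ⊢

lemma span_centerElt (hnm : 1 ≤ n + m) : Submodule.span F (Set.range (centerElt F n m c)) =
    Subalgebra.toSubmodule (Subalgebra.center F (BA F (n + 1) (m + 2) c)) := by
  refine le_antisymm (Submodule.span_le.2 ?_) fun z hz => ?_
  · rintro _ ⟨j, rfl⟩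
    exact centerElt_mem_center hnm j
  have hsum : ∑ j, coords F n m c z (centerWord n m j) • centerElt F n m c j ∈
      Submodule.span F (Set.range (centerElt F n m c)) :=
    Submodule.sum_mem _ fun j _ => Submodule.smul_mem _ _ (Submodule.subset_span ⟨j, rfl⟩)
  have hsum' : ∑ j, coords F n m c z (centerWord n m j) • centerElt F n m c j ∈
      Subalgebra.center F (BA F (n + 1) (m + 2) c) :=
    sum_mem fun j _ => Subalgebra.smul_mem _ (centerElt_mem_center hnm j) _
  have := eq_zero_of_mem_center (sub_mem hz hsum') fun i => by
    simp [coords_centerElt, -Fintype.sum_sum_type]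
  rwa [sub_eq_zero.1 this]

lemma range_centerElt : Set.range (centerElt F n m c) = ZZ F (n + 1) (m + 2) c := by
  have H := relations_BA (n := n) (m := m) (c := c)
  have h0 : centerElt F n m c (.inl 0) = 1 := H.unit
  have h1 : centerElt F n m c (.inl 1) = BGA F (n + 1) (m + 2) c ^ n *
      (Be F (n + 1) (m + 2) c * Ga F (n + 1) (m + 2) c) := rfl
  have h2 : centerElt F n m c (.inl 2) = ABG F (n + 1) (m + 2) c ^ (n + 1) :=
    H.abg_pow_eq_bga_pow.symm
  have h3 : centerElt F n m c (.inl 3) = Et F (n + 1) (m + 2) c +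
      ABG F (n + 1) (m + 2) c ^ n * Al F (n + 1) (m + 2) c := by
    simp [centerElt, path, Word.eval, ABG]
  have h4 : centerElt F n m c (.inl 4) = Et F (n + 1) (m + 2) c ^ (m + 2) := H.h_pow_eq.symm
  have h5 (i : Fin n) : centerElt F n m c (.inr (.inl i)) = ABG F (n + 1) (m + 2) c ^ (i + 1 : ℕ) +
      BGA F (n + 1) (m + 2) c ^ (i + 1 : ℕ) + GAB F (n + 1) (m + 2) c ^ (i + 1 : ℕ) := rfl
  have h6 (j : Fin m) : centerElt F n m c (.inr (.inr j)) =
      Et F (n + 1) (m + 2) c ^ (j + 2 : ℕ) := rfl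
  ext x
  simp only [ZZ, Nat.add_sub_cancel, ← h1, ← h2, ← h3, ← h0]
  constructor
  · rintro ⟨i | i | j, rfl⟩
    · fin_cases i
      · simp
      · simp
      · simp
      · simp
      · exact .inr ⟨m + 2, by simp, h4.symm⟩
    · exact .inl (.inr ⟨i + 1, by simp, (h5 i).symm⟩)
    · exact .inr ⟨j + 2, by simp, (h6 j).symm⟩
  · rintro (((rfl | rfl | rfl | rfl) | ⟨i, ⟨hi, hi'⟩, rfl⟩) | ⟨j, ⟨hj, hj'⟩, rfl⟩)
    · exact ⟨_, rfl⟩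
    · exact ⟨_, rfl⟩
    · exact ⟨_, rfl⟩
    · exact ⟨_, rfl⟩
    · obtain ⟨i, rfl⟩ := Nat.exists_eq_add_of_le' hi
      exact ⟨_, h5 ⟨i, hi'⟩⟩
    · obtain ⟨j, rfl⟩ := Nat.exists_eq_add_of_le' hj
      rcases Nat.lt_or_eq_of_le (Nat.le_of_add_le_add_right hj') with hj | rfl
      · exact ⟨_, h6 ⟨j, hj⟩⟩
      · exact ⟨_, h4⟩

end Coordinates

set_option synthInstance.maxHeartbeats 1000000 in
/-- **Basis of the center of `B^{k,t}_c` (semidihedral type, second family).**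
For `k ≥ 1`, `t ≥ 2` with `k + t ≥ 4` and `c ∈ {0,1}` the set 𝓩 is an F-basis
of `Z(B^{k,t}_c)`; in particular `dim_F Z(B^{k,t}_c) = k + t + 2`. -/
theorem semidihedral_two_center_basis
    (F : Type) [Field F] [IsAlgClosed F] [CharP F 2]
    (k t : ℕ) (hk : 1 ≤ k) (ht : 2 ≤ t) (hkt : 4 ≤ k + t) (c : F) (hc : c = 0 ∨ c = 1) :
    LinearIndependent F (fun p : (ZZ F k t c) => (p : BA F k t c)) ∧
    Submodule.span F (ZZ F k t c)
      = Subalgebra.toSubmodule (Subalgebra.center F (BA F k t c)) ∧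
    Module.finrank F ↥(Subalgebra.center F (BA F k t c)) = k + t + 2 := by
  obtain ⟨n, rfl⟩ := Nat.exists_eq_add_of_le' hk
  obtain ⟨m, rfl⟩ := Nat.exists_eq_add_of_le' ht
  have hspan := span_centerElt (F := F) (c := c) (show 1 ≤ n + m by lia)
  have hli := linearIndependent_centerElt (F := F) (n := n) (m := m) (c := c)
  rw [← range_centerElt]
  refine ⟨hli.linearIndepOn_id, hspan, ?_⟩
  have hcard := finrank_span_eq_card hli
  rw [hspan] at hcard
  refine hcard.trans ?_
  simp only [Fintype.card_sum, Fintype.card_fin]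
  lia

end SD2Paper

end
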